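/- arXiv:1906.00857 — 2 statements merged into one kernel-verified Lean document; each statement's English description precedes it below -/
import Mathlib

section
/- Let A and B be non-trivial finitely generated groups. Then the trivial subgroup of A × B is not 𝒜-separable: there exists a finite family γ₁,…,γₘ of non-identity elements of A × B such that for every n and every surjective group homomorphism f from A × B onto the alternating group Aₙ, f(γᵢ) = 1 for some i. -/
/-- In an alternating group on at most three letters, which is cyclic of order `1` or `3`, any two
nontrivial elements are equal or inverse to each other. -/
theorem alternatingGroup_eq_or_eq_inv_of_le_three {n : ℕ} (hn : n ≤ 3)
    (x y : alternatingGroup (Fin n)) :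
    x = 1 ∨ y = 1 ∨ x * y = 1 ∨ x * y⁻¹ = 1 := by
  interval_cases n <;> revert x y <;> decide +kernel

theorem alternatingGroup_four_sq_eq_one_of_commute_conj :
    ∀ x y : alternatingGroup (Fin 4), y ≠ 1 → (∀ g, Commute (g * x * g⁻¹) y) → x ^ 2 = 1 := by
  simp only [commute_iff_eq]
  decide +kernel

theorem alternatingGroup_four_exists_sq_ne_one : ∃ x : alternatingGroup (Fin 4), x ^ 2 ≠ 1 := by
  decide +kernel

section Prod

variable {A B G : Type*} [Group A] [Group B] [Group G] {f : A × B →* G}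

theorem commute_map_inl_map_inr (f : A × B →* G) (a : A) (b : B) :
    Commute (f (a, 1)) (f (1, b)) :=
  Commute.map (by simp [commute_iff_eq]) f

theorem map_eq_map_inl_mul_map_inr (f : A × B →* G) (a : A) (b : B) :
    f (a, b) = f (a, 1) * f (1, b) := by
  simp [← map_mul]

theorem commute_conj_map_inl_map_inr (hf : Function.Surjective f) (a : A) (b : B) (g : G) :
    Commute (g * f (a, 1) * g⁻¹) (f (1, b)) := by
  obtain ⟨⟨c, d⟩, rfl⟩ := hf g
  simpa [← map_inv, ← map_mul] using commute_map_inl_map_inr f (c * a * c⁻¹) b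

theorem commute_conj_map_inr_map_inl (hf : Function.Surjective f) (a : A) (b : B) (g : G) :
    Commute (g * f (1, b) * g⁻¹) (f (a, 1)) := by
  obtain ⟨⟨c, d⟩, rfl⟩ := hf g
  simpa [← map_inv, ← map_mul] using (commute_map_inl_map_inr f a (d * b * d⁻¹)).symm

/-- A surjection from a product onto a simple group with trivial center is trivial on one of the
factors. -/
theorem map_inl_eq_one_or_map_inr_eq_one_of_isSimpleGroup [IsSimpleGroup G]
    (hG : Subgroup.center G = ⊥) (hf : Function.Surjective f) (a : A) (b : B) :
    f (a, 1) = 1 ∨ f (1, b) = 1 := by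
  have hN : (((⊤ : Subgroup A).prod (⊥ : Subgroup B)).map f).Normal :=
    (Subgroup.prod_normal ⊤ ⊥).map f hf
  rcases hN.eq_bot_or_eq_top with h | h
  · have : f (a, 1) ∈ ((⊤ : Subgroup A).prod (⊥ : Subgroup B)).map f :=
      Subgroup.mem_map_of_mem f (by simp [Subgroup.mem_prod])
    exact .inl (by simpa [h] using this)
  · right
    rw [← Subgroup.mem_bot, ← hG, Subgroup.mem_center_iff]
    intro g
    obtain ⟨⟨c, _⟩, ⟨-, rfl⟩, rfl⟩ : g ∈ ((⊤ : Subgroup A).prod (⊥ : Subgroup B)).map f :=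
      h ▸ Subgroup.mem_top g
    exact commute_map_inl_map_inr f c b

end Prod

theorem map_inl_eq_one_or_map_inr_eq_one_of_alternatingGroup_four {A B : Type*} [Group A] [Group B]
    {f : A × B →* alternatingGroup (Fin 4)} (hf : Function.Surjective f) (a : A) (b : B) :
    f (a, 1) = 1 ∨ f (1, b) = 1 := by
  by_contra! h
  obtain ⟨g, hg⟩ := alternatingGroup_four_exists_sq_ne_one
  obtain ⟨⟨c, d⟩, rfl⟩ := hf g
  refine hg ?_
  rw [map_eq_map_inl_mul_map_inr, (commute_map_inl_map_inr f c d).mul_pow,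
    alternatingGroup_four_sq_eq_one_of_commute_conj _ _ h.2
      (commute_conj_map_inl_map_inr hf c b),
    alternatingGroup_four_sq_eq_one_of_commute_conj _ _ h.1
      (commute_conj_map_inr_map_inl hf a d), one_mul]

theorem map_inl_eq_one_or_map_inr_eq_one_of_alternatingGroup {A B : Type*} [Group A] [Group B]
    {n : ℕ} (hn : 4 ≤ n) {f : A × B →* alternatingGroup (Fin n)} (hf : Function.Surjective f)
    (a : A) (b : B) : f (a, 1) = 1 ∨ f (1, b) = 1 := by
  obtain rfl | hn := hn.eq_or_lt
  · exact map_inl_eq_one_or_map_inr_eq_one_of_alternatingGroup_four hf a b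
  · have := alternatingGroup.isSimpleGroup (α := Fin n) (by simpa [Nat.succ_le_iff] using hn)
    exact map_inl_eq_one_or_map_inr_eq_one_of_isSimpleGroup
      (alternatingGroup.center_eq_bot (by simpa using hn.le)) hf a b

/-- The trivial subgroup of a direct product of two nontrivial finitely generated
groups is not `𝒜`-separable. -/
theorem trivial_subgroup_not_ASeparable_of_prod {A B : Type*} [Group A] [Group B]
    [Group.FG A] [Group.FG B] [Nontrivial A] [Nontrivial B] :
    ∃ (m : ℕ) (γ : Fin m → A × B), (∀ i, γ i ≠ 1) ∧
      ∀ (n : ℕ) (f : A × B →* alternatingGroup (Fin n)),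
        Function.Surjective f → ∃ i, f (γ i) = 1 := by
  obtain ⟨a, ha⟩ := exists_ne (1 : A)
  obtain ⟨b, hb⟩ := exists_ne (1 : B)
  refine ⟨4, ![(a, 1), (1, b), (a, b), (a, b⁻¹)], by simp [Fin.forall_fin_succ, ha, hb],
    fun n f hf ↦ ?_⟩
  suffices f (a, 1) = 1 ∨ f (1, b) = 1 ∨ f (a, b) = 1 ∨ f (a, b⁻¹) = 1 by
    simpa [Fin.exists_fin_succ] using this
  rcases le_or_gt n 3 with hn | hn
  · have hinv : f (1, b⁻¹) = (f (1, b))⁻¹ := by simp [← map_inv]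
    rw [map_eq_map_inl_mul_map_inr f a b, map_eq_map_inl_mul_map_inr f a b⁻¹, hinv]
    exact alternatingGroup_eq_or_eq_inv_of_le_three hn _ _
  · exact (map_inl_eq_one_or_map_inr_eq_one_of_alternatingGroup hn hf a b).imp_right .inl
end

section
/- Let G be a finitely generated group, let H be a finite-index subgroup of G, and let K be a subgroup of H of infinite index in H. If K is 𝒜-separable in G, then K is 𝒜-separable in H. -/
def ASeparable {G : Type*} [Group G] (H : Subgroup G) : Prop :=
  ∀ (m : ℕ) (γ : Fin m → G), (∀ i, γ i ∉ H) →
    ∃ (n : ℕ) (f : G →* alternatingGroup (Fin n)),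
      Function.Surjective f ∧ ∀ i, f (γ i) ∉ H.map f

theorem MonoidHom.finite_of_fg (G P : Type*) [Group G] [Group.FG G] [Group P] [Finite P] :
    Finite (G →* P) := by
  obtain ⟨S, hS⟩ := Group.fg_def.mp ‹Group.FG G›
  refine Finite.of_injective (fun (f : G →* P) (s : S) => f s) fun f g hfg => ?_
  exact MonoidHom.eq_of_eqOn_dense hS fun s hs => congrFun hfg ⟨s, hs⟩

theorem alternatingGroup.sub_one_le_natCard_fin {n : ℕ} (hn : 2 ≤ n) :
    n - 1 ≤ Nat.card (alternatingGroup (Fin n)) := by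
  have : Nontrivial (Fin n) := Fin.nontrivial_iff_two_le.mpr hn
  have h := two_mul_nat_card_alternatingGroup (α := Fin n)
  rw [Nat.card_perm, Nat.card_fin] at h
  obtain ⟨k, rfl⟩ := Nat.exists_eq_add_of_le' (show 1 ≤ n by omega)
  rw [Nat.factorial_succ] at h
  have hk := Nat.self_le_factorial k
  have : 2 * k ≤ (k + 1) * k.factorial := Nat.mul_le_mul (by omega) hk
  omega

/-- A surjection onto a large enough alternating group remains surjective on a fixed
finite-index subgroup. -/
theorem Subgroup.map_eq_top_of_surjective_alternatingGroup {G : Type*} [Group G]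
    (H : Subgroup G) [H.FiniteIndex] {n : ℕ} (hn : H.normalCore.index + 5 ≤ n)
    (f : G →* alternatingGroup (Fin n)) (hf : Function.Surjective f) :
    H.map f = ⊤ := by
  have : (H.normalCore.map f).Normal := H.normalCore_normal.map f hf
  rcases alternatingGroup.normal_subgroup_eq_bot_or_eq_top
    (N := H.normalCore.map f) (by rw [Nat.card_fin]; omega) with h | h
  · have hker : H.normalCore ≤ f.ker := (Subgroup.map_eq_bot_iff _).mp h
    have hle : f.ker.index ≤ H.normalCore.index :=
      Nat.le_of_dvd (Nat.pos_of_ne_zero Subgroup.FiniteIndex.index_ne_zero)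
        (Subgroup.index_dvd_of_le hker)
    rw [Subgroup.index_ker, MonoidHom.range_eq_top.mpr hf, Subgroup.card_top] at hle
    have := alternatingGroup.sub_one_le_natCard_fin (n := n) (by omega)
    omega
  · exact top_le_iff.mp (h ▸ Subgroup.map_mono H.normalCore_le)

/-- An infinite-index subgroup of a finitely generated group misses some element that is killed
by every homomorphism to an alternating group of bounded degree. -/
theorem Subgroup.exists_notMem_forall_alternatingGroup_eq_one {G : Type*} [Group G] [Group.FG G]
    (K : Subgroup G) (hK : K.index = 0) (B : ℕ) :
    ∃ g ∉ K, ∀ n < B, ∀ f : G →* alternatingGroup (Fin n), f g = 1 := by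
  have (n : ℕ) : Finite (G →* alternatingGroup (Fin n)) := MonoidHom.finite_of_fg _ _
  have hM : (⨅ p : Σ n : Fin B, (G →* alternatingGroup (Fin n)), p.2.ker).FiniteIndex :=
    Subgroup.finiteIndex_iInf fun p => inferInstance
  have hle : ¬ (⨅ p : Σ n : Fin B, (G →* alternatingGroup (Fin n)), p.2.ker) ≤ K := fun hle =>
    (Subgroup.finiteIndex_of_le hle).index_ne_zero hK
  obtain ⟨g, hg, hgK⟩ := SetLike.not_le_iff_exists.mp hle
  exact ⟨g, hgK, fun n hn f => Subgroup.mem_iInf.mp hg ⟨⟨n, hn⟩, f⟩⟩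

/-- If `G` is a finitely generated group, `H ≤ G` has finite index, `K ≤ H` has
infinite index in `H`, and `K` is `𝒜`-separable in `G`, then `K` is `𝒜`-separable
in `H`. -/
theorem ASeparable_of_finiteIndex {G : Type*} [Group G] [Group.FG G]
    (H : Subgroup G) (hH : H.index ≠ 0) (K : Subgroup G) (hKH : K ≤ H)
    (hKinf : (K.subgroupOf H).index = 0) (hsep : ASeparable K) :
    ASeparable (K.subgroupOf H) := by
  intro m γ hγ
  have : H.FiniteIndex := ⟨hH⟩
  have hK : K.index = 0 := by
    rw [← Subgroup.relIndex_mul_index hKH, Subgroup.relIndex, hKinf, zero_mul]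
  obtain ⟨g, hgK, hg⟩ :=
    K.exists_notMem_forall_alternatingGroup_eq_one hK (H.normalCore.index + 5)
  obtain ⟨n, f, hf, hsepf⟩ := hsep (m + 1) (Fin.cons g fun i => (γ i : G)) <| by
    refine Fin.cases (by simpa using hgK) fun i => ?_
    simpa [Subgroup.mem_subgroupOf] using hγ i
  have hn : H.normalCore.index + 5 ≤ n := by
    by_contra! hlt
    apply hsepf 0
    rw [Fin.cons_zero, hg n hlt f]
    exact one_mem _
  refine ⟨n, f.comp H.subtype, ?_, fun i hi => ?_⟩
  · rw [← MonoidHom.range_eq_top, MonoidHom.range_comp, Subgroup.range_subtype]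
    exact H.map_eq_top_of_surjective_alternatingGroup hn f hf
  · obtain ⟨k, hk, hki⟩ := hi
    apply hsepf i.succ
    rw [Fin.cons_succ]
    exact ⟨k, hk, hki⟩
end
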